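/- arXiv:1712.05253 — 2 statements merged into one kernel-verified Lean document; each statement's English description precedes it below -/
import Mathlib

section
/- Let s>1, 0≤δ<1, 0<μ≤1, let λ:ℝ²→(0,∞), and let ψ:ℝ²→ℝ (variables (x,ξ)) be smooth and satisfy, for some C>0 and all k,l∈ℕ: |∂_x^{k}∂_ξ^{l}ψ(x,ξ)| ≤ C^{k+l+1}(k+l)!(1+(k+l)^{s-1}⟨ξ⟩_μ^{-δ})^{k+l} λ(x,ξ) ⟨ξ⟩_μ^{-l+δk}. Define ω^{i}_{j}(x,ξ) = e^{-ψ(x,ξ)}·∂_ξ^{i}∂_x^{j}e^{ψ(x,ξ)}. Then there exist B>0, C'>0, A>0 such that for all i,j,k,l∈ℕ with i+j≥1 and all (x,ξ): |∂_ξ^{k}∂_x^{l}ω^{i}_{j}(x,ξ)| ≤ C'·A^{i+j+k+l}·⟨ξ⟩_μ^{-(i+k)+δ(j+l)}·Σ_{p=0}^{i+j-1} (B·λ(x,ξ))^{i+j-p}·(k+l+p)!·(1+(k+l+p)^{s-1}⟨ξ⟩_μ^{-δ})^{k+l+p}. -/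
open scoped ContDiff

open Set

/-- `⟨ξ⟩_μ = (μ⁻² + ξ²)^(1/2)` -/
noncomputable def br (μ ξ : ℝ) : ℝ := Real.sqrt (μ⁻¹ ^ 2 + ξ ^ 2)

/-- `∂_x^k ∂_ξ^l f(x,ξ)` -/
noncomputable def pdXxi (k l : ℕ) (f : ℝ → ℝ → ℝ) (x ξ : ℝ) : ℝ :=
  iteratedDeriv k (fun x' => iteratedDeriv l (f x') ξ) x

/-- `∂_ξ^i ∂_x^j f(x,ξ)` -/
noncomputable def pdXiX (i j : ℕ) (f : ℝ → ℝ → ℝ) (x ξ : ℝ) : ℝ :=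
  iteratedDeriv i (fun ξ' => iteratedDeriv j (fun x' => f x' ξ') x) ξ

/-- `ω^i_j = e^{-ψ} ∂_ξ^i ∂_x^j e^{ψ}` -/
noncomputable def omg (ψ : ℝ → ℝ → ℝ) (i j : ℕ) (x ξ : ℝ) : ℝ :=
  Real.exp (-(ψ x ξ)) * pdXiX i j (fun x' ξ' => Real.exp (ψ x' ξ')) x ξ

noncomputable def DX (f : ℝ → ℝ → ℝ) : ℝ → ℝ → ℝ := fun x ξ => deriv (fun x' => f x' ξ) x
noncomputable def DXi (f : ℝ → ℝ → ℝ) : ℝ → ℝ → ℝ := fun x ξ => deriv (fun ξ' => f x ξ') ξ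
def Sm (f : ℝ → ℝ → ℝ) : Prop := ContDiff ℝ ∞ (Function.uncurry f)

lemma DX_iter (j : ℕ) (f : ℝ → ℝ → ℝ) :
    DX^[j] f = fun x ξ => iteratedDeriv j (fun x' => f x' ξ) x := by
  induction j with
  | zero => funext x ξ; simp
  | succ j ih =>
    rw [Function.iterate_succ_apply', ih]
    funext x ξ
    rw [iteratedDeriv_succ]; rfl

lemma DXi_iter (j : ℕ) (f : ℝ → ℝ → ℝ) :
    DXi^[j] f = fun x ξ => iteratedDeriv j (fun ξ' => f x ξ') ξ := by
  induction j with
  | zero => funext x ξ; simp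
  | succ j ih =>
    rw [Function.iterate_succ_apply', ih]
    funext x ξ
    rw [iteratedDeriv_succ]; rfl

lemma pdXiX_eq (i j : ℕ) (f : ℝ → ℝ → ℝ) : pdXiX i j f = DXi^[i] (DX^[j] f) := by
  rw [DXi_iter, DX_iter]; rfl

lemma pdXxi_eq (k l : ℕ) (f : ℝ → ℝ → ℝ) : pdXxi k l f = DX^[k] (DXi^[l] f) := by
  rw [DX_iter, DXi_iter]; rfl

lemma hasX (f : ℝ → ℝ → ℝ) (hf : Sm f) (x ξ : ℝ) :
    HasDerivAt (fun x' => f x' ξ) (fderiv ℝ (Function.uncurry f) (x, ξ) (1, 0)) x := by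
  have h1 : HasFDerivAt (Function.uncurry f) (fderiv ℝ (Function.uncurry f) (x, ξ)) (x, ξ) :=
    (ContDiff.differentiable hf (by simp) _).hasFDerivAt
  have h2 : HasDerivAt (fun x' : ℝ => (x', ξ)) ((1 : ℝ), (0 : ℝ)) x :=
    (hasDerivAt_id x).prodMk (hasDerivAt_const x ξ)
  exact HasFDerivAt.comp_hasDerivAt (f := fun x' : ℝ => (x', ξ)) x h1 h2

lemma hasXi (f : ℝ → ℝ → ℝ) (hf : Sm f) (x ξ : ℝ) :
    HasDerivAt (fun ξ' => f x ξ') (fderiv ℝ (Function.uncurry f) (x, ξ) (0, 1)) ξ := by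
  have h1 : HasFDerivAt (Function.uncurry f) (fderiv ℝ (Function.uncurry f) (x, ξ)) (x, ξ) :=
    (ContDiff.differentiable hf (by simp) _).hasFDerivAt
  have h2 : HasDerivAt (fun ξ' : ℝ => (x, ξ')) ((0 : ℝ), (1 : ℝ)) ξ :=
    (hasDerivAt_const ξ x).prodMk (hasDerivAt_id ξ)
  exact HasFDerivAt.comp_hasDerivAt (f := fun ξ' : ℝ => (x, ξ')) ξ h1 h2

lemma DX_eq (f : ℝ → ℝ → ℝ) (hf : Sm f) :
    Function.uncurry (DX f) = fun p => fderiv ℝ (Function.uncurry f) p (1, 0) := by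
  funext p; exact (hasX f hf p.1 p.2).deriv

lemma DXi_eq (f : ℝ → ℝ → ℝ) (hf : Sm f) :
    Function.uncurry (DXi f) = fun p => fderiv ℝ (Function.uncurry f) p (0, 1) := by
  funext p; exact (hasXi f hf p.1 p.2).deriv

lemma Sm.fd {f : ℝ → ℝ → ℝ} (hf : Sm f) : ContDiff ℝ ∞ (fderiv ℝ (Function.uncurry f)) :=
  ContDiff.fderiv_right (m := ∞) hf (by simp)

lemma Sm.DX {f : ℝ → ℝ → ℝ} (hf : Sm f) : Sm (DX f) := by
  unfold Sm; rw [DX_eq f hf]; exact hf.fd.clm_apply contDiff_const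

lemma Sm.DXi {f : ℝ → ℝ → ℝ} (hf : Sm f) : Sm (DXi f) := by
  unfold Sm; rw [DXi_eq f hf]; exact hf.fd.clm_apply contDiff_const

lemma Sm.DXn {f : ℝ → ℝ → ℝ} (hf : Sm f) (n : ℕ) : Sm (_root_.DX^[n] f) := by
  induction n with
  | zero => exact hf
  | succ n ih => rw [Function.iterate_succ_apply']; exact ih.DX

lemma Sm.DXin {f : ℝ → ℝ → ℝ} (hf : Sm f) (n : ℕ) : Sm (_root_.DXi^[n] f) := by
  induction n with
  | zero => exact hf
  | succ n ih => rw [Function.iterate_succ_apply']; exact ih.DXi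

lemma Sm.mul {f g : ℝ → ℝ → ℝ} (hf : Sm f) (hg : Sm g) : Sm (fun x ξ => f x ξ * g x ξ) :=
  ContDiff.mul (𝕜 := ℝ) (f := Function.uncurry f) (g := Function.uncurry g) hf hg

lemma Sm.add {f g : ℝ → ℝ → ℝ} (hf : Sm f) (hg : Sm g) : Sm (fun x ξ => f x ξ + g x ξ) :=
  ContDiff.add (𝕜 := ℝ) (f := Function.uncurry f) (g := Function.uncurry g) hf hg

lemma Sm.exp {f : ℝ → ℝ → ℝ} (hf : Sm f) : Sm (fun x ξ => Real.exp (f x ξ)) :=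
  ContDiff.exp (f := Function.uncurry f) hf

lemma Sm.neg {f : ℝ → ℝ → ℝ} (hf : Sm f) : Sm (fun x ξ => - (f x ξ)) :=
  ContDiff.neg (𝕜 := ℝ) (f := Function.uncurry f) hf

lemma D_comm {f : ℝ → ℝ → ℝ} (hf : Sm f) : DX (DXi f) = DXi (DX f) := by
  funext x ξ
  have h1 := congrFun (DX_eq _ hf.DXi) (x, ξ)
  have h2 := congrFun (DXi_eq _ hf.DX) (x, ξ)
  simp only [Function.uncurry_apply_pair] at h1 h2
  rw [h1, h2, DX_eq f hf, DXi_eq f hf]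
  have hd : DifferentiableAt ℝ (fderiv ℝ (Function.uncurry f)) (x, ξ) :=
    hf.fd.differentiable (by simp) _
  have hs : IsSymmSndFDerivAt ℝ (Function.uncurry f) (x, ξ) :=
    (ContDiff.contDiffAt hf).isSymmSndFDerivAt (by simp; exact WithTop.coe_le_coe.2 le_top)
  rw [fderiv_clm_apply hd (by fun_prop), fderiv_clm_apply hd (by fun_prop)]
  simp
  exact hs _ _

lemma D_commn {f : ℝ → ℝ → ℝ} (hf : Sm f) (l : ℕ) : DX^[l] (DXi f) = DXi (DX^[l] f) := by
  induction l with
  | zero => rfl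
  | succ l ih =>
    rw [Function.iterate_succ_apply', ih, D_comm (hf.DXn l), Function.iterate_succ_apply']

lemma D_commnn {f : ℝ → ℝ → ℝ} (hf : Sm f) (k l : ℕ) :
    DX^[l] (DXi^[k] f) = DXi^[k] (DX^[l] f) := by
  induction k with
  | zero => rfl
  | succ k ih =>
    rw [Function.iterate_succ_apply', D_commn (hf.DXin k), ih, Function.iterate_succ_apply']

lemma DX_add {f g : ℝ → ℝ → ℝ} (hf : Sm f) (hg : Sm g) :
    DX (fun x ξ => f x ξ + g x ξ) = fun x ξ => DX f x ξ + DX g x ξ := by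
  funext x ξ
  exact deriv_fun_add (hasX f hf x ξ).differentiableAt (hasX g hg x ξ).differentiableAt

lemma DXi_add {f g : ℝ → ℝ → ℝ} (hf : Sm f) (hg : Sm g) :
    DXi (fun x ξ => f x ξ + g x ξ) = fun x ξ => DXi f x ξ + DXi g x ξ := by
  funext x ξ
  exact deriv_fun_add (hasXi f hf x ξ).differentiableAt (hasXi g hg x ξ).differentiableAt

lemma DX_mul {f g : ℝ → ℝ → ℝ} (hf : Sm f) (hg : Sm g) :
    DX (fun x ξ => f x ξ * g x ξ) = fun x ξ => DX f x ξ * g x ξ + f x ξ * DX g x ξ := by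
  funext x ξ
  exact deriv_fun_mul (hasX f hf x ξ).differentiableAt (hasX g hg x ξ).differentiableAt

lemma DXi_mul {f g : ℝ → ℝ → ℝ} (hf : Sm f) (hg : Sm g) :
    DXi (fun x ξ => f x ξ * g x ξ) = fun x ξ => DXi f x ξ * g x ξ + f x ξ * DXi g x ξ := by
  funext x ξ
  exact deriv_fun_mul (hasXi f hf x ξ).differentiableAt (hasXi g hg x ξ).differentiableAt

lemma DX_exp {f : ℝ → ℝ → ℝ} (hf : Sm f) :
    DX (fun x ξ => Real.exp (f x ξ)) = fun x ξ => Real.exp (f x ξ) * DX f x ξ := by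
  funext x ξ
  exact deriv_exp (hasX f hf x ξ).differentiableAt

lemma DXi_exp {f : ℝ → ℝ → ℝ} (hf : Sm f) :
    DXi (fun x ξ => Real.exp (f x ξ)) = fun x ξ => Real.exp (f x ξ) * DXi f x ξ := by
  funext x ξ
  exact deriv_exp (hasXi f hf x ξ).differentiableAt

lemma DD_add {f g : ℝ → ℝ → ℝ} (hf : Sm f) (hg : Sm g) (k l : ℕ) :
    DXi^[k] (DX^[l] (fun x ξ => f x ξ + g x ξ)) =
      fun x ξ => DXi^[k] (DX^[l] f) x ξ + DXi^[k] (DX^[l] g) x ξ := by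
  have h1 : DX^[l] (fun x ξ => f x ξ + g x ξ) = fun x ξ => DX^[l] f x ξ + DX^[l] g x ξ := by
    induction l with
    | zero => rfl
    | succ l ih =>
      rw [Function.iterate_succ_apply', ih, DX_add (hf.DXn l) (hg.DXn l)]
      simp only [Function.iterate_succ_apply']
  rw [h1]
  have hf' := hf.DXn l
  have hg' := hg.DXn l
  generalize DX^[l] f = f at *
  generalize DX^[l] g = g at *
  clear h1
  induction k with
  | zero => rfl
  | succ k ih =>
    rw [Function.iterate_succ_apply', ih, DXi_add (hf'.DXin k) (hg'.DXin k)]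
    simp only [Function.iterate_succ_apply']

/-- pointwise bounds on all derivatives -/
def Bd (w v x ξ : ℝ) (f : ℝ → ℝ → ℝ) (F : ℕ → ℝ) : Prop :=
  ∀ k l : ℕ, |DXi^[k] (DX^[l] f) x ξ| ≤ w ^ k * v ^ l * F (k + l)

lemma Bd.DX {w v x ξ : ℝ} {f : ℝ → ℝ → ℝ} {F : ℕ → ℝ} (h : Bd w v x ξ f F) :
    Bd w v x ξ (DX f) (fun m => v * F (m + 1)) := by
  intro k l
  have := h k (l + 1)
  rw [Function.iterate_succ_apply] at this
  refine this.trans (le_of_eq ?_)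
  rw [pow_succ, ← add_assoc]; ring

lemma Bd.DXi {w v x ξ : ℝ} {f : ℝ → ℝ → ℝ} {F : ℕ → ℝ} (hf : Sm f) (h : Bd w v x ξ f F) :
    Bd w v x ξ (DXi f) (fun m => w * F (m + 1)) := by
  intro k l
  have := h (k + 1) l
  rw [Function.iterate_succ_apply, ← D_commn hf] at this
  refine this.trans (le_of_eq ?_)
  rw [pow_succ, add_right_comm]; ring

lemma Bd.add {w v x ξ : ℝ} {f g : ℝ → ℝ → ℝ} {F G : ℕ → ℝ} (hf : Sm f) (hg : Sm g)
    (h : Bd w v x ξ f F) (h' : Bd w v x ξ g G) :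
    Bd w v x ξ (fun x ξ => f x ξ + g x ξ) (fun m => F m + G m) := by
  intro k l
  rw [DD_add hf hg]
  refine (abs_add_le _ _).trans ?_
  rw [mul_add]
  exact add_le_add (h k l) (h' k l)

noncomputable def cv (F G : ℕ → ℝ) (m : ℕ) : ℝ :=
  ∑ q ∈ Finset.HasAntidiagonal.antidiagonal m, (m.choose q.1 : ℝ) * (F q.1 * G q.2)

lemma cv_succ (F G : ℕ → ℝ) (m : ℕ) :
    cv F G (m + 1) = cv (fun q => F (q + 1)) G m + cv F (fun q => G (q + 1)) m := by
  unfold cv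
  have := Finset.sum_antidiagonal_choose_succ_mul (fun a b => F a * G b) m
  rw [this, add_comm]
  congr 1
  refine Finset.sum_congr rfl fun q hq => ?_
  congr 2
  rw [Finset.HasAntidiagonal.mem_antidiagonal] at hq
  exact (Nat.choose_symm_of_eq_add hq.symm).symm

lemma cv_smul_left (c : ℝ) (F G : ℕ → ℝ) (m : ℕ) :
    cv (fun q => c * F q) G m = c * cv F G m := by
  unfold cv; rw [Finset.mul_sum]; exact Finset.sum_congr rfl fun q _ => by ring

lemma cv_smul_right (c : ℝ) (F G : ℕ → ℝ) (m : ℕ) :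
    cv F (fun q => c * G q) m = c * cv F G m := by
  unfold cv; rw [Finset.mul_sum]; exact Finset.sum_congr rfl fun q _ => by ring

lemma Bd.mul {w v x ξ : ℝ} {f g : ℝ → ℝ → ℝ} {F G : ℕ → ℝ} (hf : Sm f) (hg : Sm g)
    (h : Bd w v x ξ f F) (h' : Bd w v x ξ g G) :
    Bd w v x ξ (fun x ξ => f x ξ * g x ξ) (cv F G) := by
  intro k l
  induction l generalizing f g F G with
  | zero =>
    induction k generalizing f g F G with
    | zero =>
      have h1 := h 0 0
      have h2 := h' 0 0
      simp only [Function.iterate_zero, id, pow_zero, one_mul, add_zero] at h1 h2 ⊢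
      simp only [cv, Finset.Nat.antidiagonal_zero, Finset.sum_singleton, Nat.choose_self, Nat.cast_one,
        one_mul, abs_mul]
      exact mul_le_mul h1 h2 (abs_nonneg _) ((abs_nonneg _).trans h1)
    | succ k ih =>
      have e1 := ih hf.DXi hg (h.DXi hf) h'
      have e2 := ih hf hg.DXi h (h'.DXi hg)
      have e := DD_add (hf.DXi.mul hg) (hf.mul hg.DXi) k 0
      rw [cv_smul_left] at e1
      rw [cv_smul_right] at e2
      simp only [Function.iterate_zero, id, add_zero] at e1 e2 e ⊢
      rw [Function.iterate_succ_apply, DXi_mul hf hg, e, cv_succ]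
      refine (abs_add_le _ _).trans ((add_le_add e1 e2).trans (le_of_eq ?_))
      ring
  | succ l ih =>
      have e1 := ih hf.DX hg h.DX h'
      have e2 := ih hf hg.DX h h'.DX
      have e := DD_add (hf.DX.mul hg) (hf.mul hg.DX) k l
      rw [cv_smul_left] at e1
      rw [cv_smul_right] at e2
      rw [Function.iterate_succ_apply, DX_mul hf hg, e, ← add_assoc, cv_succ]
      refine (abs_add_le _ _).trans ((add_le_add e1 e2).trans (le_of_eq ?_))
      ring

lemma Bd.mono {w v x ξ : ℝ} {f : ℝ → ℝ → ℝ} {F G : ℕ → ℝ} (hw : 0 ≤ w) (hv : 0 ≤ v)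
    (h : Bd w v x ξ f F) (hFG : ∀ m, F m ≤ G m) : Bd w v x ξ f G := fun k l =>
  (h k l).trans (mul_le_mul_of_nonneg_left (hFG _) (by positivity))

lemma omg_eq (ψ : ℝ → ℝ → ℝ) (i j : ℕ) : omg ψ i j = fun x ξ => Real.exp (-(ψ x ξ)) *
    DXi^[i] (DX^[j] (fun x ξ => Real.exp (ψ x ξ))) x ξ := by
  unfold omg; rw [pdXiX_eq]

lemma omg_sm {ψ : ℝ → ℝ → ℝ} (h : Sm ψ) (i j : ℕ) : Sm (omg ψ i j) := by
  rw [omg_eq]; exact h.neg.exp.mul ((h.exp.DXn j).DXin i)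

lemma omg_xi {ψ : ℝ → ℝ → ℝ} (h : Sm ψ) (i j : ℕ) :
    omg ψ (i + 1) j = fun x ξ => DXi (omg ψ i j) x ξ + DXi ψ x ξ * omg ψ i j x ξ := by
  funext x ξ
  have e : DXi (fun x ξ => -(ψ x ξ)) x ξ = - DXi ψ x ξ := deriv.fun_neg
  rw [omg_eq ψ i j, DXi_mul h.neg.exp ((h.exp.DXn j).DXin i), DXi_exp h.neg, omg_eq]
  simp only [e, Function.iterate_succ_apply']
  ring

lemma omg_x {ψ : ℝ → ℝ → ℝ} (h : Sm ψ) (j : ℕ) :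
    omg ψ 0 (j + 1) = fun x ξ => DX (omg ψ 0 j) x ξ + DX ψ x ξ * omg ψ 0 j x ξ := by
  funext x ξ
  have e : DX (fun x ξ => -(ψ x ξ)) x ξ = - DX ψ x ξ := deriv.fun_neg
  rw [omg_eq ψ 0 j, DX_mul h.neg.exp ((h.exp.DXn j).DXin 0), DX_exp h.neg, omg_eq]
  simp only [e, Function.iterate_succ_apply', Function.iterate_zero, id]
  ring

lemma omg_zero (ψ : ℝ → ℝ → ℝ) : omg ψ 0 0 = fun _ _ => 1 := by
  funext x ξ
  rw [omg_eq]
  simp [← Real.exp_add]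

lemma omg_one_zero {ψ : ℝ → ℝ → ℝ} (h : Sm ψ) : omg ψ 1 0 = DXi ψ := by
  rw [omg_xi h, omg_zero]; funext x ξ; simp [DXi]

lemma omg_zero_one {ψ : ℝ → ℝ → ℝ} (h : Sm ψ) : omg ψ 0 1 = DX ψ := by
  rw [omg_x h, omg_zero]; funext x ξ; simp [DX]

/-- `m! (1 + m^(s-1) a)^m` -/
noncomputable def Gf (s a : ℝ) (m : ℕ) : ℝ :=
  (m.factorial : ℝ) * (1 + (m : ℝ) ^ (s - 1) * a) ^ m

noncomputable def Om (s a L A A1 : ℝ) (n m : ℕ) : ℝ :=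
  A1 ^ n * A ^ m * ∑ p ∈ Finset.range n, L ^ (n - p) * Gf s a (m + p)

lemma Gf_pos {s a : ℝ} (ha : 0 ≤ a) (m : ℕ) : 0 < Gf s a m := by
  unfold Gf; positivity

lemma Om_nonneg {s a L A A1 : ℝ} (ha : 0 ≤ a) (hL : 0 ≤ L) (hA : 0 ≤ A) (hA1 : 0 ≤ A1)
    (n m : ℕ) : 0 ≤ Om s a L A A1 n m := by
  unfold Om
  have := fun m => (Gf_pos (s := s) ha m).le
  refine mul_nonneg (by positivity) (Finset.sum_nonneg fun p _ => mul_nonneg (by positivity) (this _))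

lemma num1 {s a C : ℝ} (hs : 1 < s) (ha : 0 ≤ a) (ha1 : a ≤ 1) (hC : 0 < C) (q : ℕ) :
    C ^ (q + 2) * Gf s a (q + 1) ≤
      2 * C ^ 2 * (2 * C * (2 : ℝ) ^ (s - 1) * (2 : ℝ) ^ (s - 1)) ^ q * Gf s a q := by
  set T : ℝ := (2 : ℝ) ^ (s - 1) with hT
  have hT1 : 1 ≤ T := Real.one_le_rpow (by norm_num) (by linarith)
  have h1 : ((q : ℝ) + 1) ≤ 2 ^ q := by
    exact_mod_cast Nat.lt_two_pow_self (n := q)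
  have h2 : ((q : ℝ) + 1) ^ (s - 1) ≤ T ^ q := by
    calc ((q : ℝ) + 1) ^ (s - 1) ≤ ((2 : ℝ) ^ q) ^ (s - 1) :=
          Real.rpow_le_rpow (by positivity) h1 (by linarith)
      _ = T ^ q := by
          rw [hT, ← Real.rpow_natCast, ← Real.rpow_natCast, ← Real.rpow_mul (by norm_num),
            ← Real.rpow_mul (by norm_num), mul_comm]
  have h3 : 1 + ((q : ℝ) + 1) ^ (s - 1) * a ≤ 2 * T ^ q := by
    have : ((q : ℝ) + 1) ^ (s - 1) * a ≤ T ^ q * 1 := by gcongr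
    have := one_le_pow₀ hT1 (n := q)
    linarith
  have h4 : (1 + ((q : ℝ) + 1) ^ (s - 1) * a) ^ q ≤ (T * (1 + (q : ℝ) ^ (s - 1) * a)) ^ q := by
    rcases Nat.eq_zero_or_pos q with rfl | hq
    · simp
    · have hq' : (1 : ℝ) ≤ q := by exact_mod_cast hq
      have : ((q : ℝ) + 1) ^ (s - 1) ≤ T * (q : ℝ) ^ (s - 1) := by
        rw [hT, ← Real.mul_rpow (by norm_num) (by positivity)]
        exact Real.rpow_le_rpow (by positivity) (by linarith) (by linarith)
      gcongr
      have := mul_le_mul_of_nonneg_right this ha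
      linarith
  unfold Gf
  push_cast [Nat.factorial_succ]
  calc C ^ (q + 2) * ((((q : ℝ) + 1) * q.factorial) * (1 + ((q : ℝ) + 1) ^ (s - 1) * a) ^ (q + 1))
      = C ^ (q + 2) * q.factorial * (((q : ℝ) + 1) * (1 + ((q : ℝ) + 1) ^ (s - 1) * a) ^ q *
          (1 + ((q : ℝ) + 1) ^ (s - 1) * a)) := by ring
    _ ≤ C ^ (q + 2) * q.factorial * (2 ^ q * (T * (1 + (q : ℝ) ^ (s - 1) * a)) ^ q *
          (2 * T ^ q)) := by gcongr
    _ = _ := by simp only [mul_pow]; ring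

lemma num2 {s a : ℝ} (hs : 1 < s) (ha : 0 ≤ a) (q r p : ℕ) :
    ((q + r).choose q : ℝ) * (Gf s a q * Gf s a (r + p)) ≤ Gf s a (q + r + p) := by
  unfold Gf
  have hf : ((q + r).choose q : ℝ) * (q.factorial * (r + p).factorial) ≤ (q + r + p).factorial := by
    have h1 : (q + r).choose q ≤ (q + r + p).choose q := Nat.choose_le_choose _ (by omega)
    have h2 := Nat.choose_mul_factorial_mul_factorial (n := q + r + p) (k := q) (by omega)
    have h3 : q + r + p - q = r + p := by omega
    rw [h3] at h2
    rw [← h2, ← Nat.cast_mul, ← Nat.cast_mul, mul_assoc]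
    exact_mod_cast Nat.mul_le_mul_right _ h1
  have e1 : (1 + (q : ℝ) ^ (s - 1) * a) ≤ 1 + ((q + r + p : ℕ) : ℝ) ^ (s - 1) * a := by
    gcongr
    omega
  have e2 : (1 + ((r + p : ℕ) : ℝ) ^ (s - 1) * a) ≤ 1 + ((q + r + p : ℕ) : ℝ) ^ (s - 1) * a := by
    gcongr
    omega
  set Z := 1 + ((q + r + p : ℕ) : ℝ) ^ (s - 1) * a
  calc _ = ((q + r).choose q : ℝ) * (q.factorial * (r + p).factorial) *
        ((1 + (q : ℝ) ^ (s - 1) * a) ^ q * (1 + ((r + p : ℕ) : ℝ) ^ (s - 1) * a) ^ (r + p)) := by ring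
    _ ≤ (q + r + p).factorial * (Z ^ q * Z ^ (r + p)) := by gcongr
    _ = _ := by rw [← pow_add, add_assoc]

lemma num_conv {s a L A A1 K1 K2 : ℝ} {F : ℕ → ℝ} (hs : 1 < s) (ha : 0 ≤ a) (hL : 0 ≤ L)
    (hK1 : 0 ≤ K1) (hK2 : 0 < K2) (hA : A = 2 * K2) (hA1 : 0 ≤ A1)
    (hF : ∀ q, F q ≤ K1 * K2 ^ q * Gf s a q * L) (n m : ℕ) :
    cv F (Om s a L A A1 n) m ≤
      A1 ^ n * A ^ m * (2 * K1) * ∑ p ∈ Finset.range n, L ^ (n + 1 - p) * Gf s a (m + p) := by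
  have hA0 : 0 < A := by rw [hA]; positivity
  set S := ∑ p ∈ Finset.range n, L ^ (n + 1 - p) * Gf s a (m + p) with hS
  have hG := fun m => (Gf_pos (s := s) ha m).le
  have hS0 : 0 ≤ S := Finset.sum_nonneg fun p _ => mul_nonneg (by positivity) (hG _)
  have key : ∀ q ∈ Finset.HasAntidiagonal.antidiagonal m,
      (m.choose q.1 : ℝ) * (F q.1 * Om s a L A A1 n q.2) ≤
        A1 ^ n * A ^ m * K1 * S * (1 / 2) ^ q.1 := by
    rintro ⟨q, r⟩ hq
    rw [Finset.HasAntidiagonal.mem_antidiagonal] at hq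
    simp only at hq ⊢
    subst hq
    calc ((q + r).choose q : ℝ) * (F q * Om s a L A A1 n r)
        ≤ ((q + r).choose q : ℝ) * ((K1 * K2 ^ q * Gf s a q * L) * Om s a L A A1 n r) := by
          have := Om_nonneg (s := s) ha hL hA0.le hA1 n r
          have := hF q
          gcongr
      _ = A1 ^ n * A ^ r * K1 * K2 ^ q * ∑ p ∈ Finset.range n, L ^ (n + 1 - p) *
            (((q + r).choose q : ℝ) * (Gf s a q * Gf s a (r + p))) := by
          unfold Om
          simp only [Finset.mul_sum]
          refine Finset.sum_congr rfl fun p hp => ?_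
          have : n + 1 - p = (n - p) + 1 := by
            have := Finset.mem_range.1 hp; omega
          rw [this]; ring
      _ ≤ A1 ^ n * A ^ r * K1 * K2 ^ q * S := by
          rw [hS]
          gcongr with p hp
          exact num2 hs ha q r p
      _ = _ := by
          have : K2 = A * (1 / 2) := by rw [hA]; ring
          rw [this]; ring
  calc cv F (Om s a L A A1 n) m ≤ ∑ q ∈ Finset.HasAntidiagonal.antidiagonal m, A1 ^ n * A ^ m * K1 * S * (1 / 2) ^ q.1 :=
        Finset.sum_le_sum key
    _ = A1 ^ n * A ^ m * K1 * S * ∑ q ∈ Finset.range (m + 1), (1 / 2 : ℝ) ^ q := by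
        rw [← Finset.mul_sum, Finset.Nat.sum_antidiagonal_eq_sum_range_succ_mk]
    _ ≤ A1 ^ n * A ^ m * K1 * S * 2 := by
        gcongr
        exact sum_geometric_two_le _
    _ = _ := by ring

lemma num_step {s a L A A1 K1 K2 : ℝ} {F : ℕ → ℝ} (hs : 1 < s) (ha : 0 ≤ a) (hL : 0 ≤ L)
    (hK1 : 0 ≤ K1) (hK2 : 0 < K2) (hA : A = 2 * K2) (hA1 : A1 = A + 2 * K1)
    (hF : ∀ q, F q ≤ K1 * K2 ^ q * Gf s a q * L) (n m : ℕ) :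
    Om s a L A A1 n (m + 1) + cv F (Om s a L A A1 n) m ≤ Om s a L A A1 (n + 1) m := by
  have hA0 : 0 < A := by rw [hA]; positivity
  have hA10 : 0 ≤ A1 := by rw [hA1]; positivity
  have hG := fun m => (Gf_pos (s := s) ha m).le
  have h1 := num_conv hs ha hL hK1 hK2 hA hA10 hF n m
  set S := ∑ p ∈ Finset.range (n + 1), L ^ (n + 1 - p) * Gf s a (m + p) with hS
  have h2 : ∑ p ∈ Finset.range n, L ^ (n + 1 - p) * Gf s a (m + p) ≤ S := by
    rw [hS, Finset.sum_range_succ]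
    have := mul_nonneg (pow_nonneg hL (n + 1 - n)) (hG (m + n))
    linarith
  have h3 : ∑ p ∈ Finset.range n, L ^ (n - p) * Gf s a (m + 1 + p) ≤ S := by
    rw [hS, Finset.sum_range_succ']
    have := mul_nonneg (pow_nonneg hL (n + 1 - 0)) (hG (m + 0))
    have e : ∑ p ∈ Finset.range n, L ^ (n - p) * Gf s a (m + 1 + p) =
        ∑ p ∈ Finset.range n, L ^ (n + 1 - (p + 1)) * Gf s a (m + (p + 1)) := by
      refine Finset.sum_congr rfl fun p _ => ?_
      rw [Nat.add_sub_add_right, add_assoc, add_comm 1 p]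
    linarith
  have e1 : Om s a L A A1 n (m + 1) ≤ A1 ^ n * A ^ (m + 1) * S := by
    unfold Om; gcongr
  have e2 : cv F (Om s a L A A1 n) m ≤ A1 ^ n * A ^ m * (2 * K1) * S :=
    h1.trans (by gcongr)
  refine (add_le_add e1 e2).trans (le_of_eq ?_)
  have e3 : Om s a L A A1 (n + 1) m = A1 ^ (n + 1) * A ^ m * S := rfl
  rw [e3, pow_succ A1, show A1 ^ n * A1 = A1 ^ n * (A + 2 * K1) by rw [← hA1]]
  ring

lemma num_base {s a L A A1 K1 K2 : ℝ} {F : ℕ → ℝ} (ha : 0 ≤ a) (hL : 0 ≤ L)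
    (hK1 : 0 ≤ K1) (hK2 : 0 < K2) (hA : A = 2 * K2) (hA1 : A1 = A + 2 * K1)
    (hF : ∀ q, F q ≤ K1 * K2 ^ q * Gf s a q * L) (m : ℕ) : F m ≤ Om s a L A A1 1 m := by
  refine (hF m).trans ?_
  have hG := (Gf_pos (s := s) ha m).le
  have : K1 ≤ A1 := by rw [hA1, hA]; linarith
  have : K2 ≤ A := by rw [hA]; linarith
  have hA1' : 0 ≤ A1 := by linarith
  simp only [Om, Finset.range_one, Finset.sum_singleton, add_zero, pow_one, Nat.sub_zero]
  calc K1 * K2 ^ m * Gf s a m * L = K1 * K2 ^ m * (L * Gf s a m) := by ring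
    _ ≤ _ := by gcongr

lemma omg_bd {s a L A A1 K1 K2 w v x ξ : ℝ} {F : ℕ → ℝ} (hs : 1 < s) (ha : 0 ≤ a) (hL : 0 ≤ L)
    (hK1 : 0 ≤ K1) (hK2 : 0 < K2) (hA : A = 2 * K2) (hA1 : A1 = A + 2 * K1)
    (hF : ∀ q, F q ≤ K1 * K2 ^ q * Gf s a q * L) (hw : 0 ≤ w) (hv : 0 ≤ v)
    {ψ : ℝ → ℝ → ℝ} (hψ : Sm ψ) (hx : Bd w v x ξ (DX ψ) (fun m => v * F m))
    (hxi : Bd w v x ξ (DXi ψ) (fun m => w * F m)) (i j : ℕ) (hij : 1 ≤ i + j) :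
    Bd w v x ξ (omg ψ i j) (fun m => w ^ i * v ^ j * Om s a L A A1 (i + j) m) := by
  have stepXi : ∀ i j, Bd w v x ξ (omg ψ i j) (fun m => w ^ i * v ^ j * Om s a L A A1 (i + j) m) →
      Bd w v x ξ (omg ψ (i + 1) j)
        (fun m => w ^ (i + 1) * v ^ j * Om s a L A A1 (i + 1 + j) m) := by
    intro i j h
    rw [omg_xi hψ]
    have o := omg_sm hψ i j
    refine (Bd.add o.DXi (hψ.DXi.mul o) (h.DXi o) (Bd.mul hψ.DXi o hxi h)).mono hw hv fun m => ?_
    rw [cv_smul_left, cv_smul_right]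
    have := num_step hs ha hL hK1 hK2 hA hA1 hF (i + j) m
    rw [add_right_comm i 1 j]
    calc _ = w ^ (i + 1) * v ^ j * (Om s a L A A1 (i + j) (m + 1) + cv F (Om s a L A A1 (i + j)) m) := by
          ring
      _ ≤ _ := by gcongr
  have stepX : ∀ j, Bd w v x ξ (omg ψ 0 j) (fun m => w ^ 0 * v ^ j * Om s a L A A1 (0 + j) m) →
      Bd w v x ξ (omg ψ 0 (j + 1))
        (fun m => w ^ 0 * v ^ (j + 1) * Om s a L A A1 (0 + (j + 1)) m) := by
    intro j h
    rw [omg_x hψ]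
    have o := omg_sm hψ 0 j
    refine (Bd.add o.DX (hψ.DX.mul o) h.DX (Bd.mul hψ.DX o hx h)).mono hw hv fun m => ?_
    rw [cv_smul_left, cv_smul_right]
    have := num_step hs ha hL hK1 hK2 hA hA1 hF (0 + j) m
    rw [← add_assoc]
    calc _ = w ^ 0 * v ^ (j + 1) * (Om s a L A A1 (0 + j) (m + 1) + cv F (Om s a L A A1 (0 + j)) m) := by
          ring
      _ ≤ _ := by gcongr
  have hb := num_base ha hL hK1 hK2 hA hA1 hF
  have b10 : Bd w v x ξ (omg ψ 1 0) (fun m => w ^ 1 * v ^ 0 * Om s a L A A1 (1 + 0) m) := by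
    rw [omg_one_zero hψ]
    refine hxi.mono hw hv fun m => ?_
    simp only [pow_one, pow_zero, mul_one, add_zero]
    exact mul_le_mul_of_nonneg_left (hb m) hw
  have b01 : Bd w v x ξ (omg ψ 0 1) (fun m => w ^ 0 * v ^ 1 * Om s a L A A1 (0 + 1) m) := by
    rw [omg_zero_one hψ]
    refine hx.mono hw hv fun m => ?_
    simp only [pow_one, pow_zero, one_mul, zero_add]
    exact mul_le_mul_of_nonneg_left (hb m) hv
  have b0 : ∀ j, Bd w v x ξ (omg ψ 0 (j + 1))
      (fun m => w ^ 0 * v ^ (j + 1) * Om s a L A A1 (0 + (j + 1)) m) := by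
    intro j
    induction j with
    | zero => exact b01
    | succ j ih => exact stepX _ ih
  rcases j with _ | j
  · obtain ⟨i, rfl⟩ : ∃ i', i = i' + 1 := ⟨i - 1, by omega⟩
    clear hij
    induction i with
    | zero => exact b10
    | succ i ih => exact stepXi _ _ ih
  · clear hij
    induction i with
    | zero => exact b0 j
    | succ i ih => exact stepXi _ _ ih

theorem stmt10 (s δ μ : ℝ) (hs : 1 < s) (hδ0 : 0 ≤ δ) (hδ1 : δ < 1)
    (hμ0 : 0 < μ) (hμ1 : μ ≤ 1)
    (lam : ℝ → ℝ → ℝ) (hlam : ∀ x ξ, 0 < lam x ξ)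
    (ψ : ℝ → ℝ → ℝ) (hψsmooth : ContDiff ℝ ∞ (Function.uncurry ψ))
    (C : ℝ) (hC : 0 < C)
    (hψ : ∀ (k l : ℕ) (x ξ : ℝ),
      |pdXxi k l ψ x ξ| ≤
        C ^ (k + l + 1) * ((k + l).factorial : ℝ) *
          (1 + ((k + l : ℕ) : ℝ) ^ (s - 1) * br μ ξ ^ (-δ)) ^ (k + l) *
          lam x ξ * br μ ξ ^ (-(l : ℝ) + δ * (k : ℝ))) :
    ∃ B C' A : ℝ, 0 < B ∧ 0 < C' ∧ 0 < A ∧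
      ∀ (i j k l : ℕ), 1 ≤ i + j → ∀ (x ξ : ℝ),
        |pdXiX k l (omg ψ i j) x ξ| ≤
          C' * A ^ (i + j + k + l) * br μ ξ ^ (-((i : ℝ) + (k : ℝ)) + δ * ((j : ℝ) + (l : ℝ))) *
            ∑ p ∈ Finset.range (i + j),
              (B * lam x ξ) ^ (i + j - p) * ((k + l + p).factorial : ℝ) *
                (1 + ((k + l + p : ℕ) : ℝ) ^ (s - 1) * br μ ξ ^ (-δ)) ^ (k + l + p) := by
  set K1 : ℝ := 2 * C ^ 2 with hK1
  set K2 : ℝ := 2 * C * (2 : ℝ) ^ (s - 1) * (2 : ℝ) ^ (s - 1) with hK2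
  have hK2p : 0 < K2 := by positivity
  have hK1p : 0 < K1 := by positivity
  refine ⟨1, 1, 2 * K2 + 2 * K1, one_pos, one_pos, by positivity, ?_⟩
  intro i j k l hij x ξ
  have hμ : 1 ≤ μ⁻¹ := (one_le_inv₀ hμ0).2 hμ1
  have hb : 1 ≤ br μ ξ := by
    unfold br
    rw [Real.one_le_sqrt]
    nlinarith [sq_nonneg ξ]
  have hb0 : 0 < br μ ξ := by linarith
  set b := br μ ξ with hbdef
  set a := b ^ (-δ) with ha
  have ha0 : 0 ≤ a := by positivity
  have ha1 : a ≤ 1 := Real.rpow_le_one_of_one_le_of_nonpos hb (by linarith)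
  set w := b ^ (-1 : ℝ) with hw
  set v := b ^ δ with hv
  have hw0 : 0 ≤ w := by positivity
  have hv0 : 0 ≤ v := by positivity
  have hwv : ∀ k l : ℕ, b ^ (-(k : ℝ) + δ * (l : ℝ)) = w ^ k * v ^ l := by
    intro k l
    rw [Real.rpow_add hb0, hw, hv, ← Real.rpow_natCast, ← Real.rpow_natCast,
      ← Real.rpow_mul hb0.le, ← Real.rpow_mul hb0.le]
    congr 2; ring
  set L := lam x ξ with hLdef
  have hL : 0 < L := hlam x ξ
  have hS : Sm ψ := hψsmooth
  have hB : Bd w v x ξ ψ (fun m => C ^ (m + 1) * Gf s a m * L) := by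
    intro k l
    have := hψ l k x ξ
    rw [pdXxi_eq, D_commnn hS, ← hbdef, hwv, add_comm l k] at this
    refine this.trans (le_of_eq ?_)
    simp only [Gf]
    ring
  have hF : ∀ q, C ^ (q + 2) * Gf s a (q + 1) * L ≤ K1 * K2 ^ q * Gf s a q * L := fun q =>
    mul_le_mul_of_nonneg_right (num1 hs ha0 ha1 hC q) hL.le
  have main := omg_bd (F := fun q => C ^ (q + 2) * Gf s a (q + 1) * L) hs ha0 hL.le hK1p.le hK2p
    rfl rfl hF hw0 hv0 hS hB.DX (hB.DXi hS) i j hij k l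
  rw [pdXiX_eq]
  refine main.trans ?_
  have hexp : b ^ (-((i : ℝ) + (k : ℝ)) + δ * ((j : ℝ) + (l : ℝ))) = w ^ (i + k) * v ^ (j + l) := by
    rw [← hwv]; push_cast; rfl
  rw [hexp]
  simp only [Om, one_mul]
  have hsum : ∑ p ∈ Finset.range (i + j), L ^ (i + j - p) * ((k + l + p).factorial : ℝ) *
      (1 + ((k + l + p : ℕ) : ℝ) ^ (s - 1) * a) ^ (k + l + p) =
      ∑ p ∈ Finset.range (i + j), L ^ (i + j - p) * Gf s a (k + l + p) :=
    Finset.sum_congr rfl fun p _ => by unfold Gf; ring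
  rw [hsum]
  have hS0 : 0 ≤ ∑ p ∈ Finset.range (i + j), L ^ (i + j - p) * Gf s a (k + l + p) :=
    Finset.sum_nonneg fun p _ => mul_nonneg (by positivity) (Gf_pos ha0 _).le
  set S := ∑ p ∈ Finset.range (i + j), L ^ (i + j - p) * Gf s a (k + l + p)
  calc _ = (2 * K2 + 2 * K1) ^ (i + j) * (2 * K2) ^ (k + l) * (w ^ (i + k) * v ^ (j + l)) * S := by
        ring
    _ ≤ (2 * K2 + 2 * K1) ^ (i + j) * (2 * K2 + 2 * K1) ^ (k + l) * (w ^ (i + k) * v ^ (j + l)) * S := by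
        gcongr
        linarith
    _ = _ := by rw [← pow_add, add_assoc (i + j)]
end

section
/- Let a∈𝒢^s(ℝ) (s>1) be nonnegative and let 0≤δ<1. Then for all k,l∈ℕ there exists C>0, independent of μ∈(0,1], such that for all x,ξ∈ℝ and 0<μ≤1: |∂_x^{k}∂_ξ^{l}φ(x,ξ)| ≤ C·φ(x,ξ)^{1-k/2}·⟨ξ⟩_μ^{-l}. -/
open scoped ContDiff

open Set

/-- `φ(x,ξ) = a(x) + ⟨ξ⟩_μ^(-2δ)` -/
noncomputable def phi (a : ℝ → ℝ) (δ μ x ξ : ℝ) : ℝ := a x + br μ ξ ^ (-(2*δ))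

/-- Gevrey class `𝒢^s(ℝ)` -/
def Gevrey (s : ℝ) (a : ℝ → ℝ) : Prop :=
  ContDiff ℝ ∞ a ∧ ∃ C₀ A₀ : ℝ, 0 < C₀ ∧ 0 < A₀ ∧
    ∀ (x : ℝ) (k : ℕ), |iteratedDeriv k a x| ≤ C₀ * A₀ ^ k * (k.factorial : ℝ) ^ s

lemma glaeser (a : ℝ → ℝ) (ha : ContDiff ℝ ∞ a) (ha0 : ∀ x, 0 ≤ a x) (M : ℝ)
    (hM : ∀ x, |iteratedDeriv 2 a x| ≤ M) (x : ℝ) : (deriv a x) ^ 2 ≤ 2 * M * a x := by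
  have key : ∀ h : ℝ, 0 ≤ (M / 2) * (h * h) + deriv a x * h + a x := by
    intro h
    rcases eq_or_ne h 0 with rfl | hh
    · simpa using ha0 x
    have hc2 : ContDiff ℝ (((1 : ℕ) : WithTop ℕ∞) + 1) a := by
      have := contDiff_infty.1 ha 2
      norm_num at this ⊢
      exact_mod_cast this
    obtain ⟨y, -, hy⟩ := taylor_mean_remainder_lagrange_iteratedDeriv (f := a) (x := x + h)
      (x₀ := x) (n := 1) (by simpa using hh) hc2.contDiffOn
    have hne : x ≠ x + h := by simpa using hh
    rw [taylorWithinEval_succ, taylor_within_zero_eval,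
      iteratedDerivWithin_one, DifferentiableAt.derivWithin
        ((ha.differentiable (by simp)).differentiableAt)
        (uniqueDiffOn_uIcc hne x left_mem_uIcc)] at hy
    have h1 := (abs_le.mp (hM y)).2
    have h2 := ha0 (x + h)
    norm_num at hy
    nlinarith [mul_le_mul_of_nonneg_right h1 (sq_nonneg h)]
  have := discrim_le_zero key
  unfold discrim at this
  linarith

lemma br_ge_one {μ : ℝ} (h0 : 0 < μ) (h1 : μ ≤ 1) (ξ : ℝ) : 1 ≤ br μ ξ := by
  unfold br
  rw [Real.one_le_sqrt]
  have : 1 ≤ μ⁻¹ := (one_le_inv₀ h0).2 h1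
  nlinarith [sq_nonneg ξ]

lemma br_abs_le (μ ξ : ℝ) : |ξ| ≤ br μ ξ := by
  unfold br
  apply Real.abs_le_sqrt
  nlinarith [sq_nonneg μ⁻¹]

lemma br_contDiff {μ : ℝ} (h0 : 0 < μ) (p : ℝ) (i : ℕ) :
    ContDiff ℝ ∞ (fun ξ => ξ ^ i * br μ ξ ^ p) := by
  have hp : ∀ ξ : ℝ, 0 < μ⁻¹ ^ 2 + ξ ^ 2 := fun ξ => by positivity
  have h : ContDiff ℝ ∞ (fun ξ => br μ ξ) := by
    unfold br
    exact ContDiff.sqrt (by fun_prop) (fun ξ => (hp ξ).ne')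
  refine (contDiff_id.pow i).mul (h.rpow_const_of_ne ?_)
  intro ξ
  exact (Real.sqrt_pos.2 (hp ξ)).ne'

lemma br_deriv {μ : ℝ} (h0 : 0 < μ) (p : ℝ) (i : ℕ) :
    deriv (fun ξ => ξ ^ i * br μ ξ ^ p) =
      (fun ξ => (i : ℝ) * (ξ ^ (i - 1) * br μ ξ ^ p)) +
      (fun ξ => p * (ξ ^ (i + 1) * br μ ξ ^ (p - 2))) := by
  ext ξ
  have hp : 0 < μ⁻¹ ^ 2 + ξ ^ 2 := by positivity
  have hb : 0 < br μ ξ := Real.sqrt_pos.2 hp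
  have h1 : HasDerivAt (fun ξ => br μ ξ) (ξ / br μ ξ) ξ := by
    have := ((hasDerivAt_pow 2 ξ).const_add (μ⁻¹ ^ 2)).sqrt hp.ne'
    convert this using 1
    · rfl
    change ξ / br μ ξ = ((2 : ℕ) : ℝ) * ξ ^ (2 - 1) / (2 * br μ ξ)
    norm_num
    field_simp
  have h2 := (hasDerivAt_pow i ξ).mul (h1.rpow_const (p := p) (Or.inl hb.ne'))
  refine h2.deriv.trans ?_
  simp only [Pi.add_apply]
  have : br μ ξ ^ (p - 1) = br μ ξ ^ (p - 2) * br μ ξ := by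
    rw [← Real.rpow_add_one hb.ne']; ring_nf
  rw [this, pow_succ]
  field_simp

lemma br_bound (l : ℕ) : ∀ (i : ℕ) (p : ℝ), ∃ C : ℝ, 0 ≤ C ∧ ∀ ξ μ : ℝ, 0 < μ → μ ≤ 1 →
    |iteratedDeriv l (fun ξ => ξ ^ i * br μ ξ ^ p) ξ| ≤ C * br μ ξ ^ ((i : ℝ) + p - l) := by
  induction l with
  | zero =>
    intro i p
    refine ⟨1, zero_le_one, fun ξ μ h0 h1 => ?_⟩
    have hb : 0 < br μ ξ := zero_lt_one.trans_le (br_ge_one h0 h1 ξ)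
    simp only [iteratedDeriv_zero, Nat.cast_zero, sub_zero, one_mul]
    rw [Real.rpow_add hb, Real.rpow_natCast, abs_mul, abs_pow, abs_of_pos (Real.rpow_pos_of_pos hb p)]
    gcongr
    exact br_abs_le μ ξ
  | succ l ih =>
    intro i p
    obtain ⟨C₁, hC₁, h₁⟩ := ih (i - 1) p
    obtain ⟨C₂, hC₂, h₂⟩ := ih (i + 1) (p - 2)
    refine ⟨i * C₁ + |p| * C₂, by positivity, fun ξ μ h0 h1 => ?_⟩
    have e1 := (br_contDiff h0 p (i - 1)).of_le (m := ((l : ℕ∞) : WithTop ℕ∞)) (by exact_mod_cast le_top)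
    have e2 := (br_contDiff h0 (p - 2) (i + 1)).of_le (m := ((l : ℕ∞) : WithTop ℕ∞)) (by exact_mod_cast le_top)
    rw [iteratedDeriv_succ', br_deriv h0, iteratedDeriv_add
      (contDiff_const.mul e1).contDiffAt (contDiff_const.mul e2).contDiffAt,
      iteratedDeriv_const_mul_field, iteratedDeriv_const_mul_field]
    refine (abs_add_le _ _).trans ?_
    rw [abs_mul, abs_mul, Nat.abs_cast, add_mul, mul_assoc, mul_assoc]
    apply add_le_add
    · rcases Nat.eq_zero_or_pos i with rfl | hi
      · simp
      · refine mul_le_mul_of_nonneg_left ((h₁ ξ μ h0 h1).trans_eq ?_) (by positivity)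
        congr 2
        push_cast [Nat.cast_sub hi]
        ring
    · refine mul_le_mul_of_nonneg_left ((h₂ ξ μ h0 h1).trans_eq ?_) (by positivity)
      congr 2
      push_cast
      ring

theorem stmt14 (s δ : ℝ) (hs : 1 < s) (hδ0 : 0 ≤ δ) (hδ1 : δ < 1)
    (a : ℝ → ℝ) (ha : Gevrey s a) (ha0 : ∀ x, 0 ≤ a x) :
    ∀ k l : ℕ, ∃ C : ℝ, 0 < C ∧
      ∀ (x ξ μ : ℝ), 0 < μ → μ ≤ 1 →
        |pdXxi k l (phi a δ μ) x ξ| ≤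
          C * phi a δ μ x ξ ^ ((1 : ℝ) - (k : ℝ)/2) * br μ ξ ^ (-(l : ℝ)) := by
  obtain ⟨hsm, C₀, A₀, hC₀, hA₀, hG⟩ := ha
  intro k l
  have hpos : ∀ x ξ μ : ℝ, 0 < μ → μ ≤ 1 → 0 < br μ ξ ∧ 0 < phi a δ μ x ξ := by
    intro x ξ μ h0 h1
    have hb : 0 < br μ ξ := zero_lt_one.trans_le (br_ge_one h0 h1 ξ)
    exact ⟨hb, add_pos_of_nonneg_of_pos (ha0 x) (Real.rpow_pos_of_pos hb _)⟩
  rcases Nat.eq_zero_or_pos l with rfl | hl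
  · have hred : ∀ x ξ μ : ℝ, 0 < k →
        pdXxi k 0 (phi a δ μ) x ξ = iteratedDeriv k a x := by
      intro x ξ μ hk
      unfold pdXxi phi
      simp only [iteratedDeriv_zero]
      simp_rw [add_comm (a _)]
      exact iteratedDeriv_const_add hk _
    rcases k with _ | _ | k
    · refine ⟨1, one_pos, fun x ξ μ h0 h1 => ?_⟩
      obtain ⟨hb, hp⟩ := hpos x ξ μ h0 h1
      simp [pdXxi, abs_of_pos hp]
    · set M := C₀ * A₀ ^ 2 * ((Nat.factorial 2 : ℕ) : ℝ) ^ s with hM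
      have hM0 : 0 < M := by positivity
      refine ⟨Real.sqrt (2 * M), by positivity, fun x ξ μ h0 h1 => ?_⟩
      obtain ⟨hb, hp⟩ := hpos x ξ μ h0 h1
      rw [hred x ξ μ (by simp)]
      have hg := glaeser a hsm ha0 M (fun x => hG x 2) x
      have hle : a x ≤ phi a δ μ x ξ := le_add_of_nonneg_right (Real.rpow_pos_of_pos hb _).le
      have e : (1 : ℝ) - ((0 + 1 : ℕ) : ℝ) / 2 = 1 / 2 := by norm_num
      rw [e, ← Real.sqrt_eq_rpow, ← Real.sqrt_mul (by positivity)]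
      simp only [zero_add, iteratedDeriv_one, Nat.cast_zero, neg_zero, Real.rpow_zero, mul_one]
      apply Real.abs_le_sqrt
      exact hg.trans (by gcongr)
    · set B := C₀ * A₀ ^ (k + 1 + 1) * ((Nat.factorial (k + 1 + 1) : ℕ) : ℝ) ^ s with hB
      have hB0 : 0 < B := by positivity
      set e : ℝ := (1 : ℝ) - ((k + 1 + 1 : ℕ) : ℝ) / 2 with he
      have he0 : e ≤ 0 := by
        have : (0 : ℝ) ≤ k := Nat.cast_nonneg k
        rw [he]; push_cast; linarith
      refine ⟨B / (C₀ + 1) ^ e, by positivity, fun x ξ μ h0 h1 => ?_⟩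
      obtain ⟨hb, hp⟩ := hpos x ξ μ h0 h1
      rw [hred x ξ μ (by simp)]
      have hle : phi a δ μ x ξ ≤ C₀ + 1 := by
        have i1 := hG x 0
        simp at i1
        have i2 : br μ ξ ^ (-(2 * δ)) ≤ 1 :=
          Real.rpow_le_one_of_one_le_of_nonpos (br_ge_one h0 h1 ξ) (by linarith)
        exact add_le_add ((le_abs_self _).trans i1) i2
      have h3 : (C₀ + 1) ^ e ≤ phi a δ μ x ξ ^ e := Real.rpow_le_rpow_of_nonpos hp hle he0
      have h4 : 0 < (C₀ + 1) ^ e := by positivity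
      simp only [Nat.cast_zero, neg_zero, Real.rpow_zero, mul_one]
      refine (hG x (k + 1 + 1)).trans ?_
      rw [← hB, div_mul_eq_mul_div, le_div_iff₀ h4]
      gcongr
  · have hred : ∀ μ ξ : ℝ, (fun x' => iteratedDeriv l (phi a δ μ x') ξ) =
        fun _ => iteratedDeriv l (fun ξ => br μ ξ ^ (-(2 * δ))) ξ := by
      intro μ ξ
      ext x'
      exact iteratedDeriv_const_add hl _
    rcases Nat.eq_zero_or_pos k with rfl | hk
    · obtain ⟨C, hC, hbd⟩ := br_bound l 0 (-(2 * δ))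
      refine ⟨C + 1, by positivity, fun x ξ μ h0 h1 => ?_⟩
      obtain ⟨hb, hp⟩ := hpos x ξ μ h0 h1
      have h := hbd ξ μ h0 h1
      simp only [pow_zero, one_mul, Nat.cast_zero, zero_add] at h
      unfold pdXxi
      rw [hred, iteratedDeriv_zero]
      refine h.trans ?_
      rw [sub_eq_add_neg, Real.rpow_add hb, ← mul_assoc]
      simp only [Nat.cast_zero, zero_div, sub_zero, Real.rpow_one]
      have hle : br μ ξ ^ (-(2 * δ)) ≤ phi a δ μ x ξ := le_add_of_nonneg_left (ha0 x)
      gcongr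
      linarith
    · refine ⟨1, one_pos, fun x ξ μ h0 h1 => ?_⟩
      obtain ⟨hb, hp⟩ := hpos x ξ μ h0 h1
      unfold pdXxi
      rw [hred, iteratedDeriv_const, if_neg hk.ne', abs_zero]
      positivity
end
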